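/- arXiv:1901.01938 — 3 statements merged into one kernel-verified Lean document; each statement's English description precedes it below -/
import Mathlib

section
/- Let χ₁, …, χ₁₅ ∈ ℝ⁴, let b be a bijection from {1, …, 15} onto L₁, let t₁, …, t₁₅ be positive real numbers with χ_k = t_k·b(k) for all k, and let χ₀ ∈ ℝ⁴ be such that for every k ∈ {1, …, 15} there exists k' ∈ {1, …, 15} with χ_k + χ_{k'} = χ₀. Then there exists s > 0 such that ⟨χ_k, e₁⟩ = −s for all k, where ⟨·,·⟩ is the standard inner product on ℝ⁴; moreover χ₀ = −2s·e₁. -/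
open RealInnerProductSpace

noncomputable def e4 : Fin 4 → EuclideanSpace ℝ (Fin 4) :=
  fun i => EuclideanSpace.single i (1 : ℝ)

/-- The 15-element set of Section 5.2, case `j₀ = 4`, for `F₄`. -/
noncomputable def L₁ : Set (EuclideanSpace ℝ (Fin 4)) :=
  {-(e4 0)} ∪
  {v | ∃ i : Fin 4, (i = 1 ∨ i = 2 ∨ i = 3) ∧ ∃ ε : ℝ, (ε = 1 ∨ ε = -1) ∧
    v = -(e4 0) + ε • e4 i} ∪
  {v | ∃ ε₂ ε₃ ε₄ : ℝ, (ε₂ = 1 ∨ ε₂ = -1) ∧ (ε₃ = 1 ∨ ε₃ = -1) ∧ (ε₄ = 1 ∨ ε₄ = -1) ∧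
    v = (2 : ℝ)⁻¹ • (-(e4 0) + ε₂ • e4 1 + ε₃ • e4 2 + ε₄ • e4 3)}

theorem e4_apply (i j : Fin 4) : e4 i j = if j = i then (1 : ℝ) else 0 := by
  simp [e4]

theorem neg_e4_zero_mem_L₁ : -(e4 0) ∈ L₁ := Or.inl (Or.inl rfl)

theorem abs_apply_le_of_mem_L₁ {u : EuclideanSpace ℝ (Fin 4)} (hu : u ∈ L₁) (i : Fin 4) :
    |u i| ≤ -u 0 := by
  rcases hu with (rfl | ⟨j, hj, ε, hε, rfl⟩) | ⟨ε₂, ε₃, ε₄, h₂, h₃, h₄, rfl⟩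
  · fin_cases i <;> simp [e4_apply]
  · rcases hj with rfl | rfl | rfl <;> rcases hε with rfl | rfl <;> fin_cases i <;>
      simp [e4_apply]
  · rcases h₂ with rfl | rfl <;> rcases h₃ with rfl | rfl <;> rcases h₄ with rfl | rfl <;>
      fin_cases i <;> simp [e4_apply]

theorem eq_neg_e4_zero_or_exists_abs_apply_eq {u : EuclideanSpace ℝ (Fin 4)} (hu : u ∈ L₁) :
    u = -(e4 0) ∨ ∃ i : Fin 4, i ≠ 0 ∧ |u i| = -u 0 := by
  rcases hu with (rfl | ⟨j, hj, ε, hε, rfl⟩) | ⟨ε₂, ε₃, ε₄, h₂, h₃, h₄, rfl⟩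
  · exact Or.inl rfl
  · refine Or.inr ⟨j, ?_, ?_⟩ <;> rcases hj with rfl | rfl | rfl <;>
      rcases hε with rfl | rfl <;> simp [e4_apply]
  · refine Or.inr ⟨1, by simp, ?_⟩
    rcases h₂ with rfl | rfl <;> simp [e4_apply]

theorem apply_zero_of_mem_L₁ {u : EuclideanSpace ℝ (Fin 4)} (hu : u ∈ L₁) :
    u 0 = if u 1 = 0 ∨ u 2 = 0 then -1 else -2⁻¹ := by
  rcases hu with (rfl | ⟨j, hj, ε, hε, rfl⟩) | ⟨ε₂, ε₃, ε₄, h₂, h₃, h₄, rfl⟩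
  · simp [e4_apply]
  · rcases hj with rfl | rfl | rfl <;> simp [e4_apply]
  · rcases h₂ with rfl | rfl <;> rcases h₃ with rfl | rfl <;> simp [e4_apply]

theorem eq_of_smul_eq_smul_of_mem_L₁ {u v : EuclideanSpace ℝ (Fin 4)} (hu : u ∈ L₁) (hv : v ∈ L₁)
    {a c : ℝ} (ha : 0 < a) (hc : 0 < c) (h : a • u = c • v) : u = v := by
  have hcoord (i : Fin 4) : a * u i = c * v i := by
    simpa using congrArg (fun w : EuclideanSpace ℝ (Fin 4) => w i) h
  have hzero (i : Fin 4) : u i = 0 ↔ v i = 0 := by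
    rw [← mul_eq_zero_iff_left ha.ne', hcoord i, mul_eq_zero_iff_left hc.ne']
  have h0 : u 0 = v 0 := by
    rw [apply_zero_of_mem_L₁ hu, apply_zero_of_mem_L₁ hv]
    simp only [hzero]
  have hv0 : v 0 ≠ 0 := by
    rw [apply_zero_of_mem_L₁ hv]
    split_ifs <;> norm_num
  have hac : a = c := mul_right_cancel₀ hv0 (h0 ▸ hcoord 0)
  subst hac
  exact smul_right_injective _ ha.ne' h

theorem stmt15 (χ : Fin 15 → EuclideanSpace ℝ (Fin 4))
    (b : Fin 15 → EuclideanSpace ℝ (Fin 4))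
    (hb_inj : Function.Injective b) (hb_range : Set.range b = L₁)
    (t : Fin 15 → ℝ) (ht : ∀ k, 0 < t k)
    (hχ : ∀ k, χ k = t k • b k)
    (χ₀ : EuclideanSpace ℝ (Fin 4))
    (hpair : ∀ k : Fin 15, ∃ k' : Fin 15, χ k + χ k' = χ₀) :
    ∃ s : ℝ, 0 < s ∧ (∀ k : Fin 15, ⟪χ k, e4 0⟫ = -s) ∧
      χ₀ = (-(2 * s)) • e4 0 := by
  have hbL (k : Fin 15) : b k ∈ L₁ := hb_range ▸ Set.mem_range_self k
  have hinj : Function.Injective χ := fun j k hjk => hb_inj <|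
    eq_of_smul_eq_smul_of_mem_L₁ (hbL j) (hbL k) (ht j) (ht k) (by rw [← hχ, ← hχ, hjk])
  have hle (k : Fin 15) (i : Fin 4) : |χ k i| ≤ -χ k 0 := by
    have := mul_le_mul_of_nonneg_left (abs_apply_le_of_mem_L₁ (hbL k) i) (ht k).le
    simpa [hχ, abs_mul, abs_of_pos (ht k)] using this
  have hext (k : Fin 15) : b k = -(e4 0) ∨ ∃ i : Fin 4, i ≠ 0 ∧ |χ k i| = -χ k 0 := by
    refine (eq_neg_e4_zero_or_exists_abs_apply_eq (hbL k)).imp_right ?_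
    rintro ⟨i, hi, h⟩
    exact ⟨i, hi, by simp [hχ, abs_mul, abs_of_pos (ht k), h]⟩
  choose σ hσ using hpair
  have hσcoord (k : Fin 15) (i : Fin 4) : χ k i + χ (σ k) i = χ₀ i := by
    simpa using congrArg (fun w : EuclideanSpace ℝ (Fin 4) => w i) (hσ k)
  have hinv : Function.Involutive σ := fun k => hinj <| by
    have h := hσ (σ k)
    rw [← hσ k, add_comm (χ k)] at h
    exact add_left_cancel h
  obtain ⟨f, hf⟩ : ∃ f, σ f = f := by
    obtain ⟨f, hf⟩ := Equiv.Perm.exists_fixed_point_of_prime (p := 2) (n := 1) (by decide)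
      (σ := hinv.toPerm σ) (by ext k; simp [pow_two, hinv k])
    exact ⟨f, hf⟩
  obtain ⟨z, hz⟩ : ∃ z, b z = -(e4 0) := by
    have h := neg_e4_zero_mem_L₁
    rwa [← hb_range] at h
  have hzcoord (i : Fin 4) : χ z i = if i = 0 then -t z else 0 := by
    split_ifs with hi <;> simp [hχ, hz, e4_apply, hi]
  have hbf : b f = -(e4 0) := by
    refine (hext f).resolve_right ?_
    rintro ⟨i, hi, h⟩
    have hfi := hσcoord f i
    have hf0 := hσcoord f 0
    have hzi := hσcoord z i
    have hz0 := hσcoord z 0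
    have hb := hle (σ z) i
    rw [hf] at hfi hf0
    rw [hzcoord, if_neg hi] at hzi
    rw [hzcoord, if_pos rfl] at hz0
    have habs : |χ (σ z) i| = 2 * |χ f i| := by
      rw [show χ (σ z) i = 2 * χ f i by linarith, abs_mul, abs_two]
    linarith [ht z]
  obtain rfl : f = z := hb_inj (hbf.trans hz.symm)
  have hχ₀ : χ₀ = (-(2 * t f)) • e4 0 := by
    rw [← hσ f, hf, hχ, hbf]
    module
  have hmono (k : Fin 15) (hk : k ≠ f) : -χ k 0 ≤ -χ (σ k) 0 := by
    obtain h | ⟨i, hi, h⟩ := hext k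
    · exact absurd (hb_inj (h.trans hz.symm)) hk
    · have hki := hσcoord k i
      rw [← hσcoord f i, hf, hzcoord, if_neg hi] at hki
      rw [← h, show χ k i = -χ (σ k) i by linarith, abs_neg]
      exact hle (σ k) i
  refine ⟨t f, ht f, fun k => ?_, hχ₀⟩
  have hk : χ k 0 = -t f := by
    by_cases hkf : k = f
    · rw [hkf, hzcoord, if_pos rfl]
    · have h₁ := hmono k hkf
      have h₂ := hmono (σ k) fun h => hkf (hinv.injective (h.trans hf.symm))
      rw [hinv k] at h₂
      have h₃ := hσcoord k 0
      rw [← hσcoord f 0, hf, hzcoord, if_pos rfl] at h₃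
      linarith
  simpa [e4, EuclideanSpace.inner_single_right] using hk
end

section
/- Let χ₁, …, χ₁₅ ∈ ℝ⁴, let b be a bijection from {1, …, 15} onto L₂, let t₁, …, t₁₅ be positive real numbers with χ_k = t_k·b(k) for all k, and let χ₀ ∈ ℝ⁴ be such that for every k ∈ {1, …, 15} there exists k' ∈ {1, …, 15} with χ_k + χ_{k'} = χ₀. Then there exists s > 0 such that ⟨χ_k, e₁ + e₂⟩ = −s for all k, where ⟨·,·⟩ is the standard inner product on ℝ⁴; moreover χ₀ = −s·(e₁ + e₂). -/
open RealInnerProductSpace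

/-- The 15-element set of Section 5.2, case `j₀ = 1`, for `F₄`. -/
noncomputable def L₂ : Set (EuclideanSpace ℝ (Fin 4)) :=
  {-(e4 0), -(e4 1), -(e4 0) - e4 1} ∪
  {v | ∃ j : Fin 4, (j = 0 ∨ j = 1) ∧ ∃ i : Fin 4, (i = 2 ∨ i = 3) ∧
    ∃ ε : ℝ, (ε = 1 ∨ ε = -1) ∧ v = -(e4 j) + ε • e4 i} ∪
  {v | ∃ ε₃ ε₄ : ℝ, (ε₃ = 1 ∨ ε₃ = -1) ∧ (ε₄ = 1 ∨ ε₄ = -1) ∧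
    v = (2 : ℝ)⁻¹ • (-(e4 0) - e4 1 + ε₃ • e4 2 + ε₄ • e4 3)}

theorem mem_L₂_iff (v : EuclideanSpace ℝ (Fin 4)) :
    v ∈ L₂ ↔
      v = !₂[-1, 0, 0, 0] ∨ v = !₂[0, -1, 0, 0] ∨ v = !₂[-1, -1, 0, 0] ∨
      v = !₂[-1, 0, 1, 0] ∨ v = !₂[0, -1, 1, 0] ∨ v = !₂[-1, 0, 0, 1] ∨ v = !₂[0, -1, 0, 1] ∨
      v = !₂[-1, 0, -1, 0] ∨ v = !₂[0, -1, -1, 0] ∨ v = !₂[-1, 0, 0, -1] ∨ v = !₂[0, -1, 0, -1] ∨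
      v = !₂[-1/2, -1/2, 1/2, 1/2] ∨ v = !₂[-1/2, -1/2, -1/2, 1/2] ∨
      v = !₂[-1/2, -1/2, 1/2, -1/2] ∨ v = !₂[-1/2, -1/2, -1/2, -1/2] := by
  have key (p q : EuclideanSpace ℝ (Fin 4)) (h : p = q) : v = p ↔ v = q := by rw [h]
  simp only [L₂, Set.mem_union, Set.mem_insert_iff, Set.mem_singleton_iff, Set.mem_ofPred_eq,
    or_and_right, exists_or, exists_eq_left, exists_and_left, and_or_left, or_assoc]
  refine or_congr ?_ <| or_congr ?_ <| or_congr ?_ <| or_congr ?_ <| or_congr ?_ <|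
    or_congr ?_ <| or_congr ?_ <| or_congr ?_ <| or_congr ?_ <| or_congr ?_ <| or_congr ?_ <|
    or_congr ?_ <| or_congr ?_ <| or_congr ?_ ?_
  all_goals
    apply key
    ext i
    fin_cases i <;> norm_num [e4, Fin.ext_iff]

/-- Constraints on the coordinates `(x, y, z, w)` of a positive multiple of a member of `L₂`. -/
theorem coord_constraints_of_mem_L₂ {v : EuclideanSpace ℝ (Fin 4)} (hv : v ∈ L₂) {r : ℝ}
    (hr : 0 < r) {x y z w : ℝ}
    (hx : r * v 0 = x) (hy : r * v 1 = y) (hz : r * v 2 = z) (hw : r * v 3 = w) :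
    x ≤ 0 ∧ y ≤ 0 ∧ x + y < 0 ∧
    (z = 0 → w = 0 → x = 0 ∨ y = 0 ∨ (v = !₂[-1, -1, 0, 0] ∧ x = -r ∧ y = -r)) ∧
    (z ≠ 0 → w = 0 → (x = 0 ∨ y = 0) ∧ (z = x + y ∨ z = -(x + y))) ∧
    (z = 0 → w ≠ 0 → (x = 0 ∨ y = 0) ∧ (w = x + y ∨ w = -(x + y))) ∧
    (z ≠ 0 → w ≠ 0 → x = y ∧ (z = x ∨ z = -x)) := by
  subst hx hy hz hw
  rw [mem_L₂_iff] at hv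
  rcases hv with h | h | h | h | h | h | h | h | h | h | h | h | h | h | h <;>
    simp [h, hr, hr.le, hr.ne'] <;> norm_num <;> first | linarith | (constructor <;> linarith)

/-- If positive multiples `τ v • v` of the members of `L₂` pair up to the common sum `x`, then
their inner products with `e₁ + e₂` have a common value `-s < 0`, and `x = -s • (e₁ + e₂)`. -/
theorem exists_level_of_pairing (τ : EuclideanSpace ℝ (Fin 4) → ℝ) (x : EuclideanSpace ℝ (Fin 4))
    (hτ : ∀ v ∈ L₂, 0 < τ v)
    (hx : ∀ v ∈ L₂, ∃ v' ∈ L₂, ∀ i, τ v * v i + τ v' * v' i = x i) :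
    ∃ s : ℝ, 0 < s ∧ (∀ v ∈ L₂, τ v * (v 0 + v 1) = -s) ∧
      x 0 = -s ∧ x 1 = -s ∧ x 2 = 0 ∧ x 3 = 0 := by
  choose f hf hx using hx
  have partner := fun v hv => coord_constraints_of_mem_L₂ (hf v hv) (hτ _ (hf v hv))
    (eq_sub_of_add_eq' (hx v hv 0)) (eq_sub_of_add_eq' (hx v hv 1))
    (eq_sub_of_add_eq' (hx v hv 2)) (eq_sub_of_add_eq' (hx v hv 3))
  have h_mem₁ : !₂[-1, 0, 0, 0] ∈ L₂ := by simp [mem_L₂_iff]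
  have h_mem₂ : !₂[0, -1, 0, 0] ∈ L₂ := by simp [mem_L₂_iff]
  have h_mem₁₂ : !₂[-1, -1, 0, 0] ∈ L₂ := by simp [mem_L₂_iff]
  have h_mem₁₃ : !₂[-1, 0, 1, 0] ∈ L₂ := by simp [mem_L₂_iff]
  have hx : x 0 = -2 * τ !₂[-1, -1, 0, 0] ∧ x 1 = -2 * τ !₂[-1, -1, 0, 0] ∧ x 2 = 0 ∧ x 3 = 0 := by
    have p₁ := partner _ h_mem₁
    have p₂ := partner _ h_mem₂
    have p₁₂ := partner _ h_mem₁₂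
    have p₁₃ := partner _ h_mem₁₃
    have t₁ := hτ _ h_mem₁
    have t₂ := hτ _ h_mem₂
    have t₁₂ := hτ _ h_mem₁₂
    have t₁₃ := hτ _ h_mem₁₃
    simp only [Matrix.cons_val, mul_neg, mul_one, mul_zero, sub_neg_eq_add,
      sub_zero] at p₁ p₂ p₁₂ p₁₃
    clear partner
    generalize x 0 = p, x 1 = q, x 2 = z, x 3 = w at *
    have h₂ : z = 0 := by grind
    have h₃ : w = 0 := by grind
    have h₀ : p = q := by grind
    obtain hp | hp | ⟨hv, hp, -⟩ := p₁₂.2.2.2.1 h₂ h₃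
    · grind
    · grind
    · rw [hv] at hp
      grind
  obtain ⟨h0, h1, h2, h3⟩ := hx
  have hs := hτ _ h_mem₁₂
  refine ⟨2 * τ !₂[-1, -1, 0, 0], by linarith, fun v hv => ?_, by linarith, by linarith, h2, h3⟩
  have h := partner v hv
  have h' := coord_constraints_of_mem_L₂ hv (hτ v hv) rfl rfl rfl rfl
  rw [h0, h1, h2, h3] at h
  rw [mul_add]
  clear partner
  generalize τ v * v 0 = X, τ v * v 1 = Y, τ v * v 2 = Z, τ v * v 3 = W at *
  have hc (u) (hu : u = !₂[-1, -1, 0, 0]) : τ u = τ !₂[-1, -1, 0, 0] := by rw [hu]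
  simp only [zero_sub, neg_eq_zero, ne_eq] at h
  obtain ⟨-, -, -, h₁, h₂, h₃, h₄⟩ := h
  obtain ⟨-, -, -, h₁', h₂', h₃', h₄'⟩ := h'
  by_cases hZ : Z = 0 <;> by_cases hW : W = 0
  · obtain h' | h' | ⟨he, h', h''⟩ := h₁' hZ hW
    on_goal 3 => linarith [hc _ he]
    all_goals
      obtain h | h | ⟨he, h, h''⟩ := h₁ hZ hW
      on_goal 3 => linarith [hc _ he]
      all_goals linarith
  · obtain ⟨h' | h', -⟩ := h₃' hZ hW <;> obtain ⟨h | h, -⟩ := h₃ hZ hW <;> linarith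
  · obtain ⟨h' | h', -⟩ := h₂' hZ hW <;> obtain ⟨h | h, -⟩ := h₂ hZ hW <;> linarith
  · obtain ⟨-, h | h⟩ := h₄ hZ hW <;> obtain ⟨hXY, h' | h'⟩ := h₄' hZ hW <;> linarith

theorem stmt16 (χ : Fin 15 → EuclideanSpace ℝ (Fin 4))
    (b : Fin 15 → EuclideanSpace ℝ (Fin 4))
    (hb_inj : Function.Injective b) (hb_range : Set.range b = L₂)
    (t : Fin 15 → ℝ) (ht : ∀ k, 0 < t k)
    (hχ : ∀ k, χ k = t k • b k)
    (χ₀ : EuclideanSpace ℝ (Fin 4))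
    (hpair : ∀ k : Fin 15, ∃ k' : Fin 15, χ k + χ k' = χ₀) :
    ∃ s : ℝ, 0 < s ∧ (∀ k : Fin 15, ⟪χ k, e4 0 + e4 1⟫ = -s) ∧
      χ₀ = (-s) • (e4 0 + e4 1) := by
  have hτ (k) : Function.extend b t 0 (b k) = t k := hb_inj.extend_apply t 0 k
  obtain ⟨s, hs, hlevel, h0, h1, h2, h3⟩ :=
    exists_level_of_pairing (Function.extend b t 0) χ₀
      (by
        rw [← hb_range]
        rintro _ ⟨k, rfl⟩
        rw [hτ]
        exact ht k)
      (by
        rw [← hb_range]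
        rintro _ ⟨k, rfl⟩
        obtain ⟨k', h⟩ := hpair k
        refine ⟨b k', ⟨k', rfl⟩, fun i => ?_⟩
        simp [hτ, ← h, hχ])
  refine ⟨s, hs, fun k => ?_, ?_⟩
  · rw [← hlevel (b k) (hb_range ▸ ⟨k, rfl⟩), hτ, hχ]
    simp [e4, inner_add_right, EuclideanSpace.inner_single_right]
    ring
  · ext i
    fin_cases i <;> simp [e4, h0, h1, h2, h3]
end

section
/- Let χ₁, …, χ₅₇ ∈ ℝ⁸, let b be a bijection from {1, …, 57} onto L₃, let t₁, …, t₅₇ be positive real numbers with χ_k = t_k·b(k) for all k, and let χ₀ ∈ ℝ⁸ be such that for every k ∈ {1, …, 57} there exists k' ∈ {1, …, 57} with χ_k + χ_{k'} = χ₀. Then there exists s > 0 such that ⟨χ_k, e₈ + e₇⟩ = −s for all k, where ⟨·,·⟩ is the standard inner product on ℝ⁸; moreover χ₀ = −s·(e₈ + e₇). -/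
open RealInnerProductSpace
open scoped Classical

noncomputable def e8 : Fin 8 → EuclideanSpace ℝ (Fin 8) :=
  fun i => EuclideanSpace.single i (1 : ℝ)

/-- The 57-element set of Section 5.4, for `E₈` (here `e₈, e₇` are the basis vectors
of indices `7, 6`, and `e_i`, `1 ≤ i ≤ 6`, those of indices `0, …, 5`). -/
noncomputable def L₃ : Set (EuclideanSpace ℝ (Fin 8)) :=
  {-(e8 7) - e8 6} ∪
  {v | ∃ j : Fin 8, (j = 7 ∨ j = 6) ∧ ∃ i : Fin 8, (i : ℕ) < 6 ∧
    ∃ ε : ℝ, (ε = 1 ∨ ε = -1) ∧ v = -(e8 j) + ε • e8 i} ∪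
  {v | ∃ ε : Fin 6 → ℝ, (∀ i, ε i = 1 ∨ ε i = -1) ∧
    Even (Finset.univ.filter (fun i => ε i = -1)).card ∧
    v = (2 : ℝ)⁻¹ • (-(e8 7) - e8 6 +
      ∑ i : Fin 6, ε i • e8 (i.castLE (by norm_num)))}

/-- The vector `-e₈ - e₇` distinguished in `L₃`. -/
noncomputable def topRoot : EuclideanSpace ℝ (Fin 8) := -(e8 7) - e8 6

lemma inner_topRoot_self : ⟪topRoot, topRoot⟫ = (2 : ℝ) := by
  simp [-inner_self_eq_norm_sq_to_K, topRoot, e8, PiLp.inner_apply, Fin.sum_univ_eight]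
  norm_num

lemma inner_self_of_mem_L₃ {v : EuclideanSpace ℝ (Fin 8)} (hv : v ∈ L₃) :
    ⟪v, v⟫ = (2 : ℝ) := by
  rcases hv with (hv | ⟨j, hj, i, hi, ε, hε, rfl⟩) | ⟨ε, hε, -, rfl⟩
  · rw [Set.mem_singleton_iff.mp hv]
    exact inner_topRoot_self
  · have hij : i ≠ j := by
      rintro rfl
      rcases hj with rfl | rfl <;> simp at hi
    have hε2 : ε * ε = 1 := by rcases hε with rfl | rfl <;> norm_num
    simp [-inner_self_eq_norm_sq_to_K, e8, inner_add_left, inner_add_right,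
      real_inner_smul_left, real_inner_smul_right, EuclideanSpace.inner_single_left, hij, hij.symm]
    linarith
  · have hε2 : ∀ i, ε i * ε i = 1 := fun i => by rcases hε i with h | h <;> rw [h] <;> norm_num
    simp [-inner_self_eq_norm_sq_to_K, e8, PiLp.inner_apply, Fin.sum_univ_eight, Fin.sum_univ_six]
    linarith [hε2 0, hε2 1, hε2 2, hε2 3, hε2 4, hε2 5]

lemma eq_topRoot_or_inner_eq_one {v : EuclideanSpace ℝ (Fin 8)} (hv : v ∈ L₃) :
    v = topRoot ∨ ⟪v, topRoot⟫ = (1 : ℝ) := by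
  rcases hv with (hv | ⟨j, hj, i, hi, ε, -, rfl⟩) | ⟨ε, -, -, rfl⟩
  · exact Or.inl hv
  · right
    have h6 : i ≠ 6 := by rintro rfl; simp at hi
    have h7 : i ≠ 7 := by rintro rfl; simp at hi
    rcases hj with rfl | rfl <;>
      simp [topRoot, e8, inner_add_left, inner_sub_right, real_inner_smul_left,
        EuclideanSpace.inner_single_left, h6, h7]
  · right
    simp [topRoot, e8, PiLp.inner_apply, Fin.sum_univ_eight, Fin.sum_univ_six]
    norm_num

/-- If an odd family is injective and stable under `x ↦ x₀ - x`, some member is half of `x₀`. -/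
lemma exists_add_self_eq_of_odd {ι A : Type*} [Fintype ι] [AddCommGroup A] {x : ι → A} {x₀ : A}
    (hodd : Odd (Fintype.card ι)) (hx : Function.Injective x) (hpair : ∀ k, ∃ l, x k + x l = x₀) :
    ∃ k, x k + x k = x₀ := by
  choose σ hσ using hpair
  have hσσ : Function.Involutive σ := fun k => hx <| by
    have h := (hσ (σ k)).trans (hσ k).symm
    rw [add_comm (x k)] at h
    exact add_left_cancel h
  obtain ⟨k, hk⟩ := Equiv.Perm.exists_fixed_point_of_prime (p := 2) (n := 1)
    hodd.not_two_dvd_nat (σ := hσσ.toPerm) (by ext k; simpa [pow_two] using hσσ k)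
  exact ⟨k, (congrArg (x k + x ·) hk).symm.trans (hσ k)⟩

section Pairing

variable {ι E : Type*} [NormedAddCommGroup E] [InnerProductSpace ℝ E]
  {b : ι → E} {t : ι → ℝ} {x₀ : E}

/-- Positive multiples of distinct vectors of equal norm are distinct. -/
lemma injective_smul_of_inner_self_eq_two (hb : Function.Injective b)
    (hb2 : ∀ k, ⟪b k, b k⟫ = (2 : ℝ)) (ht : ∀ k, 0 < t k) :
    Function.Injective fun k => t k • b k := by
  intro k l (hkl : t k • b k = t l • b l)
  have hsq : t k * t k = t l * t l := by
    have h := congrArg (fun x => ⟪x, x⟫) hkl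
    simp only [real_inner_smul_left, real_inner_smul_right, hb2] at h
    linarith
  rw [(mul_self_inj (ht k).le (ht l).le).mp hsq] at hkl
  exact hb (smul_right_injective E (ht l).ne' hkl)

/-- Let `b` be an odd family of distinct vectors of squared norm two, all but the member `b k₀`
having inner product one with `b k₀`. If positive multiples of the members pair up with constant
sum `x₀`, then `x₀` is a positive multiple of `b k₀`. -/
theorem exists_eq_smul_of_pairing [Fintype ι] (hodd : Odd (Fintype.card ι)) (hb : Function.Injective b)
    (hb2 : ∀ k, ⟪b k, b k⟫ = (2 : ℝ)) (ht : ∀ k, 0 < t k) (k₀ : ι)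
    (hbθ : ∀ k, b k = b k₀ ∨ ⟪b k, b k₀⟫ = (1 : ℝ))
    (hpair : ∀ k, ∃ l, t k • b k + t l • b l = x₀) :
    ∃ s : ℝ, 0 < s ∧ (∀ k, ⟪t k • b k, b k₀⟫ = s) ∧ x₀ = s • b k₀ := by
  obtain ⟨f, hf⟩ := exists_add_self_eq_of_odd hodd
    (injective_smul_of_inner_self_eq_two hb hb2 ht) hpair
  have hle : ∀ k l, ⟪b k, b l⟫ ≤ (2 : ℝ) := fun k l => by
    have h := real_inner_self_nonneg (x := b k - b l)
    rw [real_inner_sub_sub_self, hb2, hb2] at h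
    linarith
  -- Each pairing relation is used through its inner products with members of the family.
  have hin : ∀ {k l m n : ι}, t k • b k + t l • b l = t m • b m + t m • b m →
      t k * ⟪b k, b n⟫ + t l * ⟪b l, b n⟫ = 2 * (t m * ⟪b m, b n⟫) := fun {k l m n} h => by
    have h' := congrArg (fun x => ⟪x, b n⟫) h
    simp only [inner_add_left, real_inner_smul_left] at h'
    linarith
  have hfθ : f = k₀ := by
    by_contra hne
    have hfi : ⟪b f, b k₀⟫ = (1 : ℝ) := (hbθ f).resolve_left fun h => hne (hb h)
    obtain ⟨l, hl⟩ := hpair k₀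
    have h₁ := hin (n := k₀) (hl.trans hf.symm)
    have h₂ := hin (n := f) (hl.trans hf.symm)
    rw [hb2, hfi] at h₁
    rw [hb2, real_inner_comm, hfi] at h₂
    have := ht k₀
    have := ht l
    rcases hbθ l with h | h
    · rw [h, hb2] at h₁
      rw [h, real_inner_comm, hfi] at h₂
      linarith
    · rw [h] at h₁
      nlinarith [mul_le_mul_of_nonneg_left (hle l f) (ht l).le]
  subst hfθ
  refine ⟨2 * t f, by linarith [ht f], fun k => ?_, by rw [← hf, ← add_smul, two_mul]⟩
  rw [real_inner_smul_left]
  rcases hbθ k with h | h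
  · rw [h, hb h, hb2, mul_comm]
  obtain ⟨l, hl⟩ := hpair k
  have h₁ := hin (n := f) (hl.trans hf.symm)
  have h₂ := hin (n := k) (hl.trans hf.symm)
  have h₃ := hin (n := l) (hl.trans hf.symm)
  rw [h, hb2] at h₁
  rw [hb2, real_inner_comm (b k) (b f), h] at h₂
  have := ht k
  have := ht l
  rcases hbθ l with hl' | hl'
  · rw [hl', hb2] at h₁
    rw [hl', real_inner_comm, h] at h₂
    linarith
  · rw [hl'] at h₁
    rw [hb2, real_inner_comm (b l) (b f), hl', real_inner_comm (b l) (b k)] at h₃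
    have hprod : (t k - t l) * (2 - ⟪b l, b k⟫) = 0 := by linarith
    rcases mul_eq_zero.mp hprod with h0 | h0
    · rw [h]
      linarith
    · rw [show ⟪b l, b k⟫ = (2 : ℝ) by linarith] at h₂
      linarith

end Pairing

theorem stmt17 (χ : Fin 57 → EuclideanSpace ℝ (Fin 8))
    (b : Fin 57 → EuclideanSpace ℝ (Fin 8))
    (hb_inj : Function.Injective b) (hb_range : Set.range b = L₃)
    (t : Fin 57 → ℝ) (ht : ∀ k, 0 < t k)
    (hχ : ∀ k, χ k = t k • b k)
    (χ₀ : EuclideanSpace ℝ (Fin 8))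
    (hpair : ∀ k : Fin 57, ∃ k' : Fin 57, χ k + χ k' = χ₀) :
    ∃ s : ℝ, 0 < s ∧ (∀ k : Fin 57, ⟪χ k, e8 7 + e8 6⟫ = -s) ∧
      χ₀ = (-s) • (e8 7 + e8 6) := by
  obtain ⟨k₀, hk₀⟩ : topRoot ∈ Set.range b := hb_range ▸ Or.inl (Or.inl rfl)
  have hmem : ∀ k, b k ∈ L₃ := fun k => hb_range ▸ Set.mem_range_self k
  have hneg : e8 7 + e8 6 = -b k₀ := by rw [hk₀, topRoot]; abel
  obtain ⟨s, hs, hin, hx⟩ := exists_eq_smul_of_pairing (x₀ := χ₀) (by decide) hb_inj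
    (fun k => inner_self_of_mem_L₃ (hmem k)) ht k₀
    (fun k => hk₀ ▸ eq_topRoot_or_inner_eq_one (hmem k)) (by simpa only [hχ] using hpair)
  refine ⟨s, hs, fun k => ?_, ?_⟩
  · rw [hneg, inner_neg_right, hχ, hin]
  · rw [hneg, hx, neg_smul, smul_neg, neg_neg]
end
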